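/- arXiv:math/0110293 — 6 statements merged into one kernel-verified Lean document; each statement's English description precedes it below -/
import Mathlib

section
/- Let K be a (not necessarily commutative) ring with unit e, ∂ a derivation on K, and α a ring automorphism of K commuting with ∂. Suppose Γ ∈ K is a unit and A ∈ K satisfies ∂(A) = 0, and suppose Γ satisfies the two equations ∂(Γ) = α(Γ) and ∂(∂(Γ)) + Γ = A·α(Γ). Then the logarithmic derivative γ := Γ⁻¹·∂(Γ) is a unit of K and satisfies the abstract Toda equation ∂(γ⁻¹·∂(γ)) = γ⁻¹·α(γ) − α⁻¹(γ⁻¹)·γ. -/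
/-- Lemma 1: the logarithmic derivative `γ = Γ⁻¹·∂Γ` of a unit `Γ` satisfying
`∂Γ = α(Γ)` and `∂²Γ + Γ = A·α(Γ)` (with `∂A = 0`) is a unit and satisfies the
abstract Toda equation `∂(γ⁻¹·∂γ) = γ⁻¹·α(γ) − α⁻¹(γ⁻¹)·γ`. -/
theorem abstract_toda_of_log_derivative {K : Type*} [Ring K]
    (D : K → K)
    (Dadd : ∀ x y : K, D (x + y) = D x + D y)
    (Dmul : ∀ x y : K, D (x * y) = D x * y + x * D y)
    (α : K ≃+* K) (hαD : ∀ x : K, D (α x) = α (D x))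
    (Γ : Kˣ) (A : K) (hA : D A = 0)
    (h1 : D (Γ : K) = α (Γ : K))
    (h2 : D (D (Γ : K)) + (Γ : K) = A * α (Γ : K)) :
    IsUnit ((↑Γ⁻¹ : K) * D (Γ : K)) ∧
      D (Ring.inverse ((↑Γ⁻¹ : K) * D (Γ : K)) * D ((↑Γ⁻¹ : K) * D (Γ : K))) =
        Ring.inverse ((↑Γ⁻¹ : K) * D (Γ : K)) * α ((↑Γ⁻¹ : K) * D (Γ : K)) -
          α.symm (Ring.inverse ((↑Γ⁻¹ : K) * D (Γ : K))) * ((↑Γ⁻¹ : K) * D (Γ : K)) := by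
  have D_sub (x y : K) : D (x - y) = D x - D y :=
    eq_sub_of_add_eq (by rw [← Dadd, sub_add_cancel])
  have D_symm (x : K) : D (α.symm x) = α.symm (D x) :=
    α.injective (by rw [← hαD, α.apply_symm_apply, α.apply_symm_apply])
  obtain ⟨a, ha⟩ : IsUnit (α (Γ : K)) := Γ.isUnit.map α
  obtain ⟨u, hu⟩ : ∃ u : Kˣ, u = Γ⁻¹ * a := ⟨_, rfl⟩
  have hγ : (↑Γ⁻¹ : K) * D (Γ : K) = u := by rw [h1, ← ha, hu, Units.val_mul]
  have hinv (x : K) : (↑u⁻¹ : K) * x = ↑a⁻¹ * (Γ * x) := by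
    rw [hu, mul_inv_rev, inv_inv, Units.val_mul, mul_assoc]
  have hΓu : (Γ : K) * u = a := by rw [hu, Units.val_mul, Units.mul_inv_cancel_left]
  have hDΓ : D (Γ : K) = a := by rw [h1, ha]
  have hDa : D (a : K) = α a := by rw [ha, hαD, h1, ← ha]
  have hb : α (a : K) = a * α u := by
    conv_lhs => rw [← hΓu, map_mul, ← ha]
  have hAa : α (a : K) = A * a - Γ := by
    rw [← hDa, ← hDΓ, eq_sub_iff_add_eq, h2, h1]
  have hlog : (↑u⁻¹ : K) * D u = α u - u := by
    have h := Dmul (Γ : K) u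
    rw [hΓu, hDΓ, hDa, hb] at h
    rw [hinv, ← sub_eq_iff_eq_add'.mpr h, ← mul_sub, Units.inv_mul_cancel_left]
  have hDα : D (α u) = ↑u⁻¹ * α u - 1 := by
    have h : D (a * α u) = A * (a * α u) - a := by
      rw [← hb, hAa, D_sub, Dmul, hA, hDΓ, hDa, zero_mul, zero_add, hAa]
    rw [Dmul, hDa, hAa, sub_mul, mul_assoc, sub_add, sub_right_inj] at h
    rw [hinv, sub_eq_iff_eq_add.mp h, mul_add, Units.inv_mul, Units.inv_mul_cancel_left,
      add_sub_cancel_left]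
  have hDu : D (u : K) = α.symm ↑u⁻¹ * u - 1 := by
    rw [← α.symm_apply_apply (u : K), D_symm, hDα]
    simp
  rw [hγ, Ring.inverse_unit]
  refine ⟨u.isUnit, ?_⟩
  rw [hlog, D_sub, hDα, hDu, sub_sub_sub_cancel_right]
end

section
/- Let K be a (not necessarily commutative) ring with unit e, ∂ a derivation on K, and α a ring automorphism of K commuting with ∂. If Γ ∈ K is a unit satisfying ∂(Γ) = α(Γ), then γ := Γ⁻¹·∂(Γ) satisfies ∂(γ) − γ·(α(γ) − γ) = 0. -/
/-- A map satisfying the Leibniz rule sends the inverse of a unit `u` to `-u⁻¹ (D u) u⁻¹`. -/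
theorem leibniz_units_inv {K : Type*} [Ring K] (D : K → K)
    (Dmul : ∀ x y : K, D (x * y) = D x * y + x * D y) (u : Kˣ) :
    D (↑u⁻¹ : K) = -((↑u⁻¹ : K) * D (u : K) * (↑u⁻¹ : K)) := by
  have D_one : D 1 = 0 := by simpa using Dmul 1 1
  have h : D (u : K) * (↑u⁻¹ : K) + u * D (↑u⁻¹ : K) = 0 := by
    rw [← Dmul, Units.mul_inv, D_one]
  rw [mul_assoc, eq_neg_of_add_eq_zero_left h, mul_neg, neg_neg, Units.inv_mul_cancel_left]

/-- The first of equations (1.4): if `∂Γ = α(Γ)` then `γ = Γ⁻¹·∂Γ` satisfies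
`∂γ − γ·(α(γ) − γ) = 0`. -/
theorem first_gamma_equation {K : Type*} [Ring K]
    (D : K → K)
    (Dadd : ∀ x y : K, D (x + y) = D x + D y)
    (Dmul : ∀ x y : K, D (x * y) = D x * y + x * D y)
    (α : K ≃+* K) (hαD : ∀ x : K, D (α x) = α (D x))
    (Γ : Kˣ) (h1 : D (Γ : K) = α (Γ : K)) :
    D ((↑Γ⁻¹ : K) * D (Γ : K)) -
      ((↑Γ⁻¹ : K) * D (Γ : K)) *
        (α ((↑Γ⁻¹ : K) * D (Γ : K)) - (↑Γ⁻¹ : K) * D (Γ : K)) = 0 := by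
  have h_inv : α (Γ : K) * α (↑Γ⁻¹ : K) = 1 := by
    rw [← map_mul, Units.mul_inv, map_one]
  have h_cancel : (↑Γ⁻¹ : K) * α (Γ : K) * (α (↑Γ⁻¹ : K) * α (α (Γ : K))) =
      (↑Γ⁻¹ : K) * α (α (Γ : K)) := by
    rw [mul_assoc, ← mul_assoc (α (Γ : K)), h_inv, one_mul]
  rw [Dmul, leibniz_units_inv D Dmul, h1, hαD, h1, map_mul, mul_sub, h_cancel]
  noncomm_ring
end

section
/- Let K be a (not necessarily commutative) ring with unit e, ∂ a derivation on K, and α a ring automorphism of K commuting with ∂. Suppose Γ ∈ K is a unit and A ∈ K satisfies ∂(A) = 0, and suppose ∂(Γ) = α(Γ) and ∂(∂(Γ)) + Γ = A·α(Γ). Then γ := Γ⁻¹·∂(Γ) satisfies ∂(∂(γ)) + 2·γ·∂(γ) − (γ² + ∂(γ) + e)·(α(γ) − γ) = 0. -/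
/-- The second of equations (1.4): under equations (1.2), `γ = Γ⁻¹·∂Γ` satisfies
`∂²γ + 2γ·∂γ − (γ² + ∂γ + e)·(α(γ) − γ) = 0`. -/
theorem second_gamma_equation {K : Type*} [Ring K]
    (D : K → K)
    (Dadd : ∀ x y : K, D (x + y) = D x + D y)
    (Dmul : ∀ x y : K, D (x * y) = D x * y + x * D y)
    (α : K ≃+* K) (hαD : ∀ x : K, D (α x) = α (D x))
    (Γ : Kˣ) (A : K) (hA : D A = 0)
    (h1 : D (Γ : K) = α (Γ : K))
    (h2 : D (D (Γ : K)) + (Γ : K) = A * α (Γ : K)) :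
    D (D ((↑Γ⁻¹ : K) * D (Γ : K))) +
      2 * ((↑Γ⁻¹ : K) * D (Γ : K)) * D ((↑Γ⁻¹ : K) * D (Γ : K)) -
      (((↑Γ⁻¹ : K) * D (Γ : K)) ^ 2 + D ((↑Γ⁻¹ : K) * D (Γ : K)) + 1) *
        (α ((↑Γ⁻¹ : K) * D (Γ : K)) - (↑Γ⁻¹ : K) * D (Γ : K)) = 0 := by
  have D_one : D 1 = 0 := by simpa using Dmul 1 1
  obtain ⟨g, hg⟩ : ∃ g : K, g = (↑Γ⁻¹ : K) * D (Γ : K) := ⟨_, rfl⟩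
  rw [← hg]
  have hDΓ : D (Γ : K) = Γ * g := by rw [hg, Units.mul_inv_cancel_left]
  have hP : A * α (Γ : K) = Γ * (g ^ 2 + D g + 1) := by
    rw [← h2, hDΓ, Dmul, hDΓ]
    noncomm_ring
  have hDP : A * α (Γ : K) * α g =
      Γ * g * (g ^ 2 + D g + 1) + Γ * (D g * g + g * D g + D (D g)) := by
    have h := congrArg D hP
    rw [Dmul, hA, hαD, hDΓ, map_mul, Dmul, hDΓ, Dadd, Dadd, D_one, pow_two, Dmul] at h
    simpa [mul_assoc, pow_two] using h
  have key : (g ^ 2 + D g + 1) * α g =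
      g * (g ^ 2 + D g + 1) + (D g * g + g * D g + D (D g)) := by
    rw [← Units.mul_right_inj Γ, ← mul_assoc, ← hP, hDP, mul_assoc, ← mul_add]
  rw [mul_sub, key]
  noncomm_ring
end

section
/- Let K be a (not necessarily commutative) ring with unit e, ∂ a derivation on K, and α a ring automorphism of K commuting with ∂. Suppose γ ∈ K is a unit satisfying the two equations ∂(γ) − γ·(α(γ) − γ) = 0 and ∂(∂(γ)) + 2·γ·∂(γ) − (γ² + ∂(γ) + e)·(α(γ) − γ) = 0. Then γ satisfies ∂(γ⁻¹·∂(γ)) = γ⁻¹·α(γ) − α⁻¹(γ⁻¹)·γ. -/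
/-- Part 1 of the proof of Lemma 1: equations (1.4) for a unit `γ` imply the
abstract Toda equation (1.3). -/
theorem toda_of_gamma_equations {K : Type*} [Ring K]
    (D : K → K)
    (Dadd : ∀ x y : K, D (x + y) = D x + D y)
    (Dmul : ∀ x y : K, D (x * y) = D x * y + x * D y)
    (α : K ≃+* K) (hαD : ∀ x : K, D (α x) = α (D x))
    (γ : Kˣ)
    (h1 : D (γ : K) - (γ : K) * (α (γ : K) - (γ : K)) = 0)
    (h2 : D (D (γ : K)) + 2 * (γ : K) * D (γ : K) -
      ((γ : K) ^ 2 + D (γ : K) + 1) * (α (γ : K) - (γ : K)) = 0) :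
    D ((↑γ⁻¹ : K) * D (γ : K)) =
      (↑γ⁻¹ : K) * α (γ : K) - α.symm (↑γ⁻¹ : K) * (γ : K) := by
  have hD : D (γ : K) = γ * (α γ - γ) := sub_eq_zero.mp h1
  have hsub : D (α γ - γ) = D (α (γ : K)) - D (γ : K) := by
    rw [eq_sub_iff_add_eq, ← Dadd, sub_add_cancel]
  have hDD : D (D (γ : K)) =
      D (γ : K) * (α γ - γ) + γ * (D (α (γ : K)) - D (γ : K)) := by
    conv_lhs => rw [hD]
    rw [Dmul, hsub]
  have hγ : (γ : K) * D (α (γ : K)) = α γ - γ := by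
    rw [hDD, hD] at h2
    rw [← sub_eq_zero, ← h2]
    noncomm_ring
  have hα : D (α (γ : K)) = (↑γ⁻¹ : K) * α γ - 1 := by
    rw [← Units.inv_mul_cancel_left γ (D (α (γ : K))), hγ, mul_sub, Units.inv_mul]
  have hsymm : D (γ : K) = α.symm (↑γ⁻¹ : K) * γ - 1 := by
    apply α.injective
    rw [← hαD, hα]
    simp
  rw [hD, Units.inv_mul_cancel_left, hsub, hα, hsymm]
  abel
end

section
/- Let K be a (not necessarily commutative) ring with unit e, ∂ a derivation on K, and α a ring automorphism of K commuting with ∂. Suppose γ ∈ K is a unit satisfying ∂(γ) − γ·(α(γ) − γ) = 0 and ∂(∂(γ)) + 2·γ·∂(γ) − (γ² + ∂(γ) + e)·(α(γ) − γ) = 0. Then α(∂(γ)) = γ⁻¹·α(γ) − e, and equivalently ∂(γ) = α⁻¹(γ⁻¹)·γ − e. -/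
/-- The key intermediate identity in the proof of Lemma 1:
`α(∂γ) = γ⁻¹·α(γ) − e` and equivalently `∂γ = α⁻¹(γ⁻¹)·γ − e`. -/
theorem gamma_derivative_identity {K : Type*} [Ring K]
    (D : K → K)
    (Dadd : ∀ x y : K, D (x + y) = D x + D y)
    (Dmul : ∀ x y : K, D (x * y) = D x * y + x * D y)
    (α : K ≃+* K) (hαD : ∀ x : K, D (α x) = α (D x))
    (γ : Kˣ)
    (h1 : D (γ : K) - (γ : K) * (α (γ : K) - (γ : K)) = 0)
    (h2 : D (D (γ : K)) + 2 * (γ : K) * D (γ : K) -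
      ((γ : K) ^ 2 + D (γ : K) + 1) * (α (γ : K) - (γ : K)) = 0) :
    α (D (γ : K)) = (↑γ⁻¹ : K) * α (γ : K) - 1 ∧
      D (γ : K) = α.symm (↑γ⁻¹ : K) * (γ : K) - 1 := by
  have hd : D (γ : K) = γ * (α (γ : K) - γ) := sub_eq_zero.mp h1
  have hsub : D (α (γ : K) - γ) = α (D (γ : K)) - D (γ : K) := by
    rw [← hαD, eq_sub_iff_add_eq, ← Dadd, sub_add_cancel]
  have hdd : D (D (γ : K)) =
      D (γ : K) * (α (γ : K) - γ) + γ * (α (D (γ : K)) - D (γ : K)) := by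
    conv_lhs => rw [hd]
    rw [Dmul, hsub]
  have hmul : (γ : K) * α (D (γ : K)) = α (γ : K) - γ := by
    rw [hdd] at h2
    have h := congrArg₂ (fun x y => x - (γ : K) * y) h2 h1
    simp only [mul_zero, sub_zero] at h
    rw [← sub_eq_zero]
    refine Eq.trans ?_ h
    noncomm_ring
  have hα : α (D (γ : K)) = (↑γ⁻¹ : K) * α (γ : K) - 1 := by
    rw [← Units.inv_mul_cancel_left γ (α (D (γ : K))), hmul, mul_sub, Units.inv_mul]
  refine ⟨hα, ?_⟩
  rw [← α.symm_apply_apply (D (γ : K)), hα, map_sub, map_mul, map_one, α.symm_apply_apply]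
end

section
/- Let K be a (not necessarily commutative) ring with unit e, ∂ a derivation on K, and α a ring automorphism of K commuting with ∂. Let P ∈ K satisfy P² = P, ∂(P) = 0 and α(P) = P. Suppose x is a unit of K satisfying ∂(x⁻¹·∂(x)) = x⁻¹·α(x) − α⁻¹(x⁻¹)·x and the projection condition P·x = P·x·P, and suppose there exists y ∈ K with P·y·P = y and y·(P·x·P) = (P·x·P)·y = P (i.e. P·x·P is invertible in the corner ring P·K·P with inverse y). Then ∂(y·∂(P·x·P)) = y·α(P·x·P) − α⁻¹(y)·(P·x·P); that is, P·x·P is a solution of the same abstract Toda equation in the subring P·K·P. -/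
/-- Lemma 2: if a unit `x` satisfies the abstract Toda equation and the
projection condition `P·x = P·x·P` for a constant idempotent `P`, then `P·x·P`
satisfies the same equation in the corner ring `P·K·P` (with `y` the inverse of
`P·x·P` in that corner ring). -/
theorem toda_projection {K : Type*} [Ring K]
    (D : K → K)
    (Dadd : ∀ x y : K, D (x + y) = D x + D y)
    (Dmul : ∀ x y : K, D (x * y) = D x * y + x * D y)
    (α : K ≃+* K) (hαD : ∀ x : K, D (α x) = α (D x))
    (P : K) (hP2 : P * P = P) (hPD : D P = 0) (hPα : α P = P)
    (x : Kˣ)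
    (htoda : D ((↑x⁻¹ : K) * D (x : K)) =
      (↑x⁻¹ : K) * α (x : K) - α.symm (↑x⁻¹ : K) * (x : K))
    (hproj : P * (x : K) = P * (x : K) * P)
    (y : K) (hy : P * y * P = y)
    (hyl : y * (P * (x : K) * P) = P) (hyr : (P * (x : K) * P) * y = P) :
    D (y * D (P * (x : K) * P)) =
      y * α (P * (x : K) * P) - α.symm y * (P * (x : K) * P) := by
  have hyP : y * P = y := by rw [← hy, mul_assoc, hP2]
  have hyx : y = P * (↑x⁻¹ : K) := by
    rw [Units.eq_mul_inv_iff_mul_eq, ← hyl, ← hproj, ← mul_assoc, hyP]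
  have hDP (z : K) : D (P * z) = P * D z := by rw [Dmul, hPD, zero_mul, zero_add]
  have hPα' : α.symm P = P := by rw [RingEquiv.symm_apply_eq, hPα]
  have hyP' : α.symm y * P = α.symm y := by
    conv_lhs => rw [← hPα', ← map_mul, hyP]
  have hL : D (y * D (x : K)) = P * D ((↑x⁻¹ : K) * D (x : K)) := by
    rw [hyx, mul_assoc, hDP]
  have hy' : α.symm y = P * α.symm (↑x⁻¹ : K) := by rw [hyx, map_mul, hPα']
  rw [← hproj, hDP, map_mul, hPα, ← mul_assoc, ← mul_assoc, ← mul_assoc, hyP, hyP', hL,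
    htoda, mul_sub, ← mul_assoc, ← mul_assoc, ← hyx, ← hy']
end
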